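/- arXiv:2509.23162 — 2 statements merged into one kernel-verified Lean document; each statement's English description precedes it below -/
import Mathlib

section
/- Suppose the separation condition holds at index i, the beta constraint holds, and N > max{144 β M_W², 1/((4 M_W² + 2d(λ_max + λ_min)) β)}. Then the retrieval operator Φ has exactly one fixed point X_i* in the ball B_i. -/
open Real Finset MeasureTheory

/-- A Gaussian parameter: a pair `(m, ω)` of mean vector and vector of covariance
eigenvalues (in a fixed common eigenbasis). -/
abbrev GaussParam (d : ℕ) := (Fin d → ℝ) × (Fin d → ℝ)

/-- Bures–Wasserstein distance between two Gaussian parameters. -/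
noncomputable def dBW {d : ℕ} (x y : GaussParam d) : ℝ :=
  Real.sqrt ((∑ ℓ, (x.1 ℓ - y.1 ℓ) ^ 2) +
    ∑ ℓ, (Real.sqrt (x.2 ℓ) - Real.sqrt (y.2 ℓ)) ^ 2)

/-- Gibbs weights of the Wasserstein dense associative memory. -/
noncomputable def gibbsW {d N : ℕ} (β : ℝ) (X : Fin N → GaussParam d)
    (ξ : GaussParam d) (k : Fin N) : ℝ :=
  Real.exp (-β * (dBW (X k) ξ) ^ 2) / ∑ j, Real.exp (-β * (dBW (X j) ξ) ^ 2)

/-- The retrieval operator `Φ`. -/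
noncomputable def PhiOp {d N : ℕ} (β : ℝ) (X : Fin N → GaussParam d)
    (ξ : GaussParam d) : GaussParam d :=
  (fun ℓ => ∑ k, gibbsW β X ξ k * (X k).1 ℓ,
   fun ℓ => (∑ k, gibbsW β X ξ k * Real.sqrt ((X k).2 ℓ)) ^ 2)

/-- `I(X_i, X_j) = − log ⟨X_i , X_j⟩_{L²}` for Gaussian parameters with a common
eigenbasis. -/
noncomputable def Ifun {d : ℕ} (x y : GaussParam d) : ℝ :=
  (d / 2 : ℝ) * Real.log (2 * Real.pi)
    + (1 / 2) * ∑ ℓ, Real.log (x.2 ℓ + y.2 ℓ)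
    + (1 / 2) * ∑ ℓ, (x.1 ℓ - y.1 ℓ) ^ 2 / (x.2 ℓ + y.2 ℓ)


theorem le_of_sq_le_sqR {a b : ℝ} (h : a ^ 2 ≤ b ^ 2) (hb : 0 ≤ b) : a ≤ b :=
  (le_abs_self a).trans (abs_le_of_sq_le_sq h hb)

theorem exp_sub_exp_le {a b c : ℝ} (ha : a ≤ c) (hb : b ≤ c) :
    |Real.exp a - Real.exp b| ≤ Real.exp c * |a - b| := by
  have key : ∀ a b : ℝ, a ≤ c → b ≤ a → |Real.exp a - Real.exp b| ≤ Real.exp c * |a - b| := by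
    intro a b ha hba
    rw [abs_of_nonneg (sub_nonneg.2 (Real.exp_le_exp.2 hba)), abs_of_nonneg (sub_nonneg.2 hba)]
    have h1 : Real.exp b = Real.exp a * Real.exp (b - a) := by rw [← Real.exp_add]; ring_nf
    have h2 := Real.add_one_le_exp (b - a)
    have h3 := Real.exp_le_exp.2 ha
    have h4 := Real.exp_pos a
    have h5 : Real.exp a * (b - a + 1) ≤ Real.exp b := by
      rw [h1]; exact mul_le_mul_of_nonneg_left h2 h4.le
    have h6 : Real.exp a * (a - b) ≤ Real.exp c * (a - b) :=
      mul_le_mul_of_nonneg_right h3 (sub_nonneg.2 hba)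
    linarith
  rcases le_total b a with h | h
  · exact key a b ha h
  · rw [abs_sub_comm, abs_sub_comm a b]; exact key b a hb h

/-- Euclidean soft-max mean. -/
noncomputable def softT {E : Type*} [NormedAddCommGroup E] [InnerProductSpace ℝ E] {N : ℕ}
    (β : ℝ) (Y : Fin N → E) (y : E) : E :=
  ∑ k, (Real.exp (-β * ‖Y k - y‖ ^ 2) / ∑ j, Real.exp (-β * ‖Y j - y‖ ^ 2)) • Y k

/-- Unnormalised weights relative to index `i`. -/
noncomputable def relU {E : Type*} [NormedAddCommGroup E] [InnerProductSpace ℝ E] {N : ℕ}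
    (β : ℝ) (Y : Fin N → E) (i : Fin N) (y : E) (k : Fin N) : ℝ :=
  Real.exp (-β * (‖Y k - Y i‖ ^ 2 - 2 * inner ℝ (Y k - Y i) (y - Y i)))

theorem softT_eq {E : Type*} [NormedAddCommGroup E] [InnerProductSpace ℝ E] {N : ℕ}
    (β : ℝ) (Y : Fin N → E) (i : Fin N) (y : E) :
    softT β Y y = Y i + ∑ k, (relU β Y i y k / ∑ j, relU β Y i y j) • (Y k - Y i) := by
  have h : ∀ k, Real.exp (-β * ‖Y k - y‖ ^ 2)
      = Real.exp (-β * ‖Y i - y‖ ^ 2) * relU β Y i y k := by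
    intro k
    rw [relU, ← Real.exp_add]
    congr 1
    have h1 : Y k - y = (Y k - Y i) - (y - Y i) := by abel
    have h2 : Y i - y = - (y - Y i) := by abel
    rw [h1, norm_sub_sq_real, h2, norm_neg]
    ring
  have hS : 0 < ∑ j, relU β Y i y j :=
    Finset.sum_pos (fun j _ => Real.exp_pos _) ⟨i, Finset.mem_univ i⟩
  have hw : ∑ k, (relU β Y i y k / ∑ j, relU β Y i y j) = 1 := by
    rw [← Finset.sum_div, div_self hS.ne']
  simp only [smul_sub, Finset.sum_sub_distrib]
  rw [← Finset.sum_smul, hw, one_smul, add_sub_cancel]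
  unfold softT
  refine Finset.sum_congr rfl fun k _ => ?_
  rw [Finset.sum_congr rfl (fun j _ => h j), h k]
  rw [← Finset.mul_sum, mul_div_mul_left _ _ (Real.exp_pos _).ne']

theorem softT_unique {E : Type*} [NormedAddCommGroup E] [InnerProductSpace ℝ E] [CompleteSpace E]
    {N : ℕ} (hN : 0 < N) (β M A : ℝ) (hβ : 0 < β) (Y : Fin N → E) (i : Fin N)
    (hM : ∀ k, ‖Y k‖ ≤ M) (hA : 4 * M ^ 2 ≤ A)
    (hP : Real.exp 2 ≤ (N : ℝ) ^ 3 * β * A)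
    (hD : ∀ j, j ≠ i → 4 * Real.log ((N : ℝ) ^ 3 * β * A) ≤ β * ‖Y j - Y i‖ ^ 2)
    (hNb : 144 * β * M ^ 2 < N) :
    ∃! y : E, ‖Y i - y‖ ≤ 1 / Real.sqrt (β * N) ∧ softT β Y y = y := by
  set P := (N : ℝ) ^ 3 * β * A with hPdef
  set r := 1 / Real.sqrt (β * N) with hr
  have hN' : (1 : ℝ) ≤ N := by exact_mod_cast hN
  have hbN : 0 < β * N := by positivity
  have hr0 : 0 < r := by positivity
  have hr2 : r ^ 2 * (β * N) = 1 := by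
    rw [hr, div_pow, Real.sq_sqrt hbN.le]; field_simp
  have hM0 : 0 ≤ M := (norm_nonneg _).trans (hM i)
  have hP0 : 0 < P := (Real.exp_pos 2).trans_le hP
  have hL : 2 ≤ Real.log P := (Real.le_log_iff_exp_le hP0).2 hP
  have hP4 : 3 ≤ P := by have := Real.add_one_le_exp 2; linarith
  have hY : ∀ k, ‖Y k - Y i‖ ≤ 2 * M := fun k => by
    have := norm_sub_le (Y k) (Y i); have := hM k; have := hM i; linarith
  have hβMr : 4 * β * M * r ≤ 1 / 3 := by
    refine le_of_sq_le_sqR ?_ (by norm_num)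
    have : (4 * β * M * r) ^ 2 * N = 16 * β * M ^ 2 * (r ^ 2 * (β * N)) := by ring
    rw [hr2] at this
    nlinarith
  have hexpo : ∀ y, ‖Y i - y‖ ≤ r → ∀ k, k ≠ i →
      -β * (‖Y k - Y i‖ ^ 2 - 2 * inner ℝ (Y k - Y i) (y - Y i)) ≤ -3 * Real.log P := by
    intro y hy k hk
    have h1 := real_inner_le_norm (Y k - Y i) (y - Y i)
    rw [norm_sub_rev] at hy
    have h2 : ‖Y k - Y i‖ * ‖y - Y i‖ ≤ (2 * M) * r :=
      mul_le_mul (hY k) hy (norm_nonneg _) (by positivity)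
    have h3 := hD k hk
    have h4 : β * inner ℝ (Y k - Y i) (y - Y i) ≤ β * (2 * M * r) :=
      mul_le_mul_of_nonneg_left (h1.trans h2) hβ.le
    nlinarith
  have hexpP : Real.exp (-3 * Real.log P) = (P ^ 3)⁻¹ := by
    rw [← Real.exp_log (pow_pos hP0 3), ← Real.exp_neg, Real.log_pow]; norm_num
  have hself : ∀ y, relU β Y i y i = 1 := by intro y; simp [relU]
  have hupos : ∀ y k, 0 < relU β Y i y k := fun y k => Real.exp_pos _
  have hS1 : ∀ y, 1 ≤ ∑ k, relU β Y i y k := by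
    intro y
    rw [← hself y]
    exact Finset.single_le_sum (fun k _ => (hupos y k).le) (Finset.mem_univ i)
  have hub : ∀ y, ‖Y i - y‖ ≤ r → ∀ k, k ≠ i → relU β Y i y k ≤ (P ^ 3)⁻¹ := by
    intro y hy k hk
    rw [← hexpP]
    exact Real.exp_le_exp.2 (hexpo y hy k hk)
  have hmaps : ∀ y, ‖Y i - y‖ ≤ r → ‖Y i - softT β Y y‖ ≤ r := by
    intro y hy
    rw [softT_eq β Y i y, sub_add_cancel_left, norm_neg]
    have h1 : ‖∑ k, (relU β Y i y k / ∑ j, relU β Y i y j) • (Y k - Y i)‖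
        ≤ ∑ k : Fin N, (P ^ 3)⁻¹ * (2 * M) := by
      refine norm_sum_le_of_le _ fun k _ => ?_
      by_cases hk : k = i
      · subst hk; simp; positivity
      · rw [norm_smul]
        refine mul_le_mul ?_ (hY k) (norm_nonneg _) (by positivity)
        rw [Real.norm_of_nonneg (div_nonneg (hupos y k).le (by linarith [hS1 y]))]
        exact (div_le_self (hupos y k).le (hS1 y)).trans (hub y hy k hk)
    refine h1.trans ?_
    rw [Finset.sum_const, Finset.card_univ, Fintype.card_fin, nsmul_eq_mul]
    refine le_of_sq_le_sqR ?_ hr0.le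
    have h2 : ((N : ℝ) * ((P ^ 3)⁻¹ * (2 * M))) ^ 2 * (β * N) * P ^ 6
        = N ^ 3 * β * (4 * M ^ 2) := by
      field_simp; try ring
    have h3 : (N : ℝ) ^ 3 * β * (4 * M ^ 2) ≤ P :=
      mul_le_mul_of_nonneg_left hA (by positivity)
    have h4 : P ≤ P ^ 6 := le_self_pow₀ (by linarith) (by norm_num)
    have h5 : 0 < (β * N) * P ^ 6 := by positivity
    refine le_of_mul_le_mul_right ?_ h5
    calc _ = ((N : ℝ) * ((P ^ 3)⁻¹ * (2 * M))) ^ 2 * (β * N) * P ^ 6 := by ring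
      _ ≤ P ^ 6 := by rw [h2]; exact h3.trans h4
      _ = r ^ 2 * (β * N) * P ^ 6 := by rw [hr2]; ring
      _ = _ := by ring
  have hlip : ∀ y z, ‖Y i - y‖ ≤ r → ‖Y i - z‖ ≤ r →
      ‖softT β Y y - softT β Y z‖ ≤ (1 / 2) * ‖y - z‖ := by
    intro y z hy hz
    set S := ∑ k, relU β Y i y k with hS
    set S' := ∑ k, relU β Y i z k with hS'
    have hS1y : 1 ≤ S := hS1 y
    have hS1z : 1 ≤ S' := hS1 z
    set q := (P ^ 3)⁻¹ * (2 * β * (2 * M * ‖y - z‖)) with hq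
    have hq0 : 0 ≤ q := by positivity
    have hdu : ∀ k, |relU β Y i y k - relU β Y i z k| ≤ q := by
      intro k
      by_cases hk : k = i
      · subst hk; rw [hself, hself]; simpa using hq0
      · refine (exp_sub_exp_le (hexpo y hy k hk) (hexpo z hz k hk)).trans ?_
        rw [hexpP]
        refine mul_le_mul_of_nonneg_left ?_ (by positivity)
        have h1 : -β * (‖Y k - Y i‖ ^ 2 - 2 * inner ℝ (Y k - Y i) (y - Y i))
            - -β * (‖Y k - Y i‖ ^ 2 - 2 * inner ℝ (Y k - Y i) (z - Y i))
            = 2 * β * inner ℝ (Y k - Y i) (y - z) := by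
          have : y - z = (y - Y i) - (z - Y i) := by abel
          rw [this, inner_sub_right (Y k - Y i) (y - Y i) (z - Y i)]; ring
        rw [h1, abs_mul, abs_of_pos (by positivity : 0 < 2 * β)]
        refine mul_le_mul_of_nonneg_left ?_ (by positivity)
        exact (abs_real_inner_le_norm _ _).trans
          (mul_le_mul_of_nonneg_right (hY k) (norm_nonneg _))
    have hdS : |S' - S| ≤ N * q := by
      rw [abs_sub_comm, hS, hS', ← Finset.sum_sub_distrib]
      refine (Finset.abs_sum_le_sum_abs _ _).trans ((Finset.sum_le_sum fun k _ => hdu k).trans ?_)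
      simp
    have hdw : ∀ k, |relU β Y i y k / S - relU β Y i z k / S'|
        ≤ q + relU β Y i y k / S * (N * q) := by
      intro k
      have h1 : relU β Y i y k / S - relU β Y i z k / S'
          = (relU β Y i y k - relU β Y i z k) / S' + relU β Y i y k / S * ((S' - S) / S') := by
        have : S ≠ 0 := by linarith
        have : S' ≠ 0 := by linarith
        field_simp; ring
      have hd : ∀ x : ℝ, |x / S'| ≤ |x| := fun x => by
        rw [abs_div, abs_of_pos (by linarith : 0 < S')]
        exact div_le_self (abs_nonneg _) hS1z
      rw [h1]
      refine (abs_add_le _ _).trans (add_le_add ((hd _).trans (hdu k)) ?_)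
      have hw0 : 0 ≤ relU β Y i y k / S := div_nonneg (hupos y k).le (by linarith)
      rw [abs_mul, abs_of_nonneg hw0]
      exact mul_le_mul_of_nonneg_left ((hd _).trans hdS) hw0
    have hsumw : ∑ k, relU β Y i y k / S = 1 := by
      rw [← Finset.sum_div, div_self (by linarith)]
    rw [softT_eq β Y i y, softT_eq β Y i z, add_sub_add_left_eq_sub, ← Finset.sum_sub_distrib]
    simp only [← sub_smul]
    have h1 : ‖∑ k, (relU β Y i y k / S - relU β Y i z k / S') • (Y k - Y i)‖
        ≤ ∑ k : Fin N, (q + relU β Y i y k / S * (N * q)) * (2 * M) := by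
      refine norm_sum_le_of_le _ fun k _ => ?_
      rw [norm_smul, Real.norm_eq_abs]
      exact mul_le_mul (hdw k) (hY k) (norm_nonneg _) ((abs_nonneg _).trans (hdw k))
    refine h1.trans ?_
    rw [← Finset.sum_mul, Finset.sum_add_distrib, ← Finset.sum_mul Finset.univ (fun k => relU β Y i y k / S), hsumw, Finset.sum_const,
      Finset.card_univ, Fintype.card_fin, nsmul_eq_mul]
    have h2 : ((N : ℝ) * q + 1 * (N * q)) * (2 * M)
        = (4 * (N * β * (4 * M ^ 2)) * (P ^ 3)⁻¹) * ‖y - z‖ := by rw [hq]; ring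
    rw [h2]
    refine mul_le_mul_of_nonneg_right ?_ (norm_nonneg _)
    have hA0 : 0 ≤ A := by nlinarith [sq_nonneg M]
    have h3 : (N : ℝ) * β * (4 * M ^ 2) ≤ P := by
      rw [hPdef]
      refine mul_le_mul ?_ hA (by positivity) (by positivity)
      exact mul_le_mul_of_nonneg_right (le_self_pow₀ hN' (by norm_num)) hβ.le
    rw [← div_eq_mul_inv, div_le_iff₀ (by positivity)]
    nlinarith [mul_nonneg hP0.le (by nlinarith : (0:ℝ) ≤ P ^ 2 - 9)]
  -- Banach fixed point
  have hball : ∀ y, y ∈ Metric.closedBall (Y i) r ↔ ‖Y i - y‖ ≤ r := by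
    intro y; rw [Metric.mem_closedBall, dist_comm, dist_eq_norm]
  have hmt : Set.MapsTo (softT β Y) (Metric.closedBall (Y i) r) (Metric.closedBall (Y i) r) := by
    intro y hy; rw [hball] at hy ⊢; exact hmaps y hy
  have hc : ContractingWith (1 / 2) hmt.restrict := by
    refine ⟨by rw [← NNReal.coe_lt_coe]; norm_num, ?_⟩
    refine LipschitzWith.of_dist_le_mul fun a b => ?_
    have := hlip a b ((hball _).1 a.2) ((hball _).1 b.2)
    rw [Subtype.dist_eq, Subtype.dist_eq, dist_eq_norm, dist_eq_norm]
    simpa using this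
  obtain ⟨y, hys, hyf, -⟩ := ContractingWith.exists_fixedPoint'
    (Metric.isClosed_closedBall.isComplete) hmt hc (Metric.mem_closedBall_self hr0.le)
    (edist_ne_top _ _)
  refine ⟨y, ⟨(hball y).1 hys, hyf⟩, ?_⟩
  rintro z ⟨hz, hzf⟩
  have := hlip z y hz ((hball y).1 hys)
  rw [hzf, hyf] at this
  have h0 : ‖z - y‖ = 0 := by have := norm_nonneg (z - y); linarith
  exact sub_eq_zero.1 (norm_eq_zero.1 h0)

/-- Euclidean coordinates `(m, √ω)`. -/
noncomputable def embG {d : ℕ} (x : GaussParam d) : EuclideanSpace ℝ (Fin d ⊕ Fin d) :=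
  WithLp.toLp 2 (Sum.elim x.1 (fun ℓ => Real.sqrt (x.2 ℓ)))

theorem dBW_eq {d : ℕ} (x y : GaussParam d) : dBW x y = ‖embG x - embG y‖ := by
  rw [EuclideanSpace.norm_eq, dBW]
  simp [embG, Fintype.sum_sum_type]

theorem embG_inl {d : ℕ} (x : GaussParam d) (ℓ : Fin d) : embG x (Sum.inl ℓ) = x.1 ℓ := rfl
theorem embG_inr {d : ℕ} (x : GaussParam d) (ℓ : Fin d) :
    embG x (Sum.inr ℓ) = Real.sqrt (x.2 ℓ) := rfl

theorem embG_Phi {d N : ℕ} (β : ℝ) (X : Fin N → GaussParam d) (ξ : GaussParam d) :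
    embG (PhiOp β X ξ) = softT β (fun k => embG (X k)) (embG ξ) := by
  have hw : ∀ k, 0 ≤ gibbsW β X ξ k := fun k =>
    div_nonneg (Real.exp_pos _).le (Finset.sum_nonneg fun j _ => (Real.exp_pos _).le)
  ext s
  rcases s with ℓ | ℓ
  · simp [softT, embG_inl, PhiOp, gibbsW, dBW_eq]
  · rw [embG_inr, PhiOp]
    simp only
    rw [Real.sqrt_sq (Finset.sum_nonneg fun k _ => mul_nonneg (hw k) (Real.sqrt_nonneg _))]
    simp [softT, embG_inr, gibbsW, dBW_eq]

/-- Under the separation condition, the beta constraint and the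
size condition on `N`, the retrieval operator `Φ` has exactly one fixed point
in the ball `B_i`. -/
theorem phi_unique_fixed_point
    {d N : ℕ} (hN : 0 < N) (β lamMin lamMax MW : ℝ)
    (hβpos : 0 < β) (hlam : 0 < lamMin) (hlam' : lamMin ≤ lamMax)
    (X : Fin N → GaussParam d)
    (hX : ∀ i ℓ, (X i).2 ℓ ∈ Set.Icc lamMin lamMax)
    (hMW : MW = ⨆ k, Real.sqrt ((∑ ℓ, ((X k).1 ℓ) ^ 2) + ∑ ℓ, (X k).2 ℓ))
    (i : Fin N)
    (hsep : ∀ j, j ≠ i → Ifun (X i) (X j) ≥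
      (d / 2 : ℝ) * Real.log (4 * Real.pi * lamMax) +
        (1 / (β * lamMin)) *
          Real.log ((N : ℝ) ^ 3 * β * (4 * MW ^ 2 + 2 * d * (lamMax + lamMin))))
    (hβc : β > Real.exp 2 / ((4 * MW ^ 2 + 2 * d * (lamMax + lamMin)) * (N : ℝ) ^ 3))
    (hNbig : (N : ℝ) > max (144 * β * MW ^ 2)
      (1 / ((4 * MW ^ 2 + 2 * d * (lamMax + lamMin)) * β))) :
    ∃! ξstar : GaussParam d,
      (dBW (X i) ξstar ≤ 1 / Real.sqrt (β * N) ∧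
        (∀ ℓ, ξstar.2 ℓ ∈ Set.Icc lamMin lamMax)) ∧
      PhiOp β X ξstar = ξstar := by
  rcases Nat.eq_zero_or_pos d with hd | hd
  · subst hd
    refine ⟨X i, ⟨⟨?_, fun ℓ => ℓ.elim0⟩, Subsingleton.elim _ _⟩, fun _ _ => Subsingleton.elim _ _⟩
    rw [dBW_eq, sub_self, norm_zero]; positivity
  have hd' : (1 : ℝ) ≤ d := by exact_mod_cast hd
  have hN' : (1 : ℝ) ≤ N := by exact_mod_cast hN
  have hmaxpos : 0 < lamMax := hlam.trans_le hlam'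
  set A := 4 * MW ^ 2 + 2 * d * (lamMax + lamMin) with hA
  have hApos : 0 < A := by positivity
  have hP : Real.exp 2 ≤ (N : ℝ) ^ 3 * β * A := by
    rw [gt_iff_lt, div_lt_iff₀ (by positivity)] at hβc
    nlinarith
  have hM : ∀ k, ‖embG (X k)‖ ≤ MW := by
    intro k
    have h1 : ‖embG (X k)‖ = Real.sqrt ((∑ ℓ, ((X k).1 ℓ) ^ 2) + ∑ ℓ, (X k).2 ℓ) := by
      rw [EuclideanSpace.norm_eq, Fintype.sum_sum_type]
      simp only [embG_inl, embG_inr, Real.norm_eq_abs, sq_abs]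
      congr 2
      exact Finset.sum_congr rfl fun ℓ _ => Real.sq_sqrt (hlam.le.trans (hX k ℓ).1)
    rw [h1, hMW]
    exact le_ciSup (f := fun k => Real.sqrt ((∑ ℓ, ((X k).1 ℓ) ^ 2) + ∑ ℓ, (X k).2 ℓ))
      (Set.finite_range _).bddAbove k
  have hD : ∀ j, j ≠ i → 4 * Real.log ((N : ℝ) ^ 3 * β * A) ≤ β * ‖embG (X j) - embG (X i)‖ ^ 2 := by
    intro j hj
    have hs := hsep j hj
    set L := Real.log ((N : ℝ) ^ 3 * β * A)
    have hpos : ∀ ℓ, 0 < (X i).2 ℓ + (X j).2 ℓ := fun ℓ => by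
      have := (hX i ℓ).1; have := (hX j ℓ).1; linarith
    have hlog : ∑ ℓ, Real.log ((X i).2 ℓ + (X j).2 ℓ) ≤ d * Real.log (2 * lamMax) := by
      have : ∑ ℓ, Real.log ((X i).2 ℓ + (X j).2 ℓ) ≤ ∑ ℓ : Fin d, Real.log (2 * lamMax) :=
        Finset.sum_le_sum fun ℓ _ => Real.log_le_log (hpos ℓ)
          (by have := (hX i ℓ).2; have := (hX j ℓ).2; linarith)
      simpa using this
    have hsq : ∑ ℓ, ((X i).1 ℓ - (X j).1 ℓ) ^ 2 / ((X i).2 ℓ + (X j).2 ℓ)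
        ≤ (∑ ℓ, ((X i).1 ℓ - (X j).1 ℓ) ^ 2) / (2 * lamMin) := by
      rw [Finset.sum_div]
      refine Finset.sum_le_sum fun ℓ _ => ?_
      refine div_le_div_of_nonneg_left (sq_nonneg _) (by positivity) ?_
      have := (hX i ℓ).1; have := (hX j ℓ).1; linarith
    have hl4 : Real.log (4 * Real.pi * lamMax) = Real.log (2 * Real.pi) + Real.log (2 * lamMax) := by
      rw [← Real.log_mul (by positivity) (by positivity)]; congr 1; ring
    rw [Ifun, hl4] at hs
    have h1 : 1 / (β * lamMin) * L
        ≤ (1 / 2) * ((∑ ℓ, ((X i).1 ℓ - (X j).1 ℓ) ^ 2) / (2 * lamMin)) := by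
      linarith
    have h2 : 4 * L ≤ β * ∑ ℓ, ((X i).1 ℓ - (X j).1 ℓ) ^ 2 := by
      have h3 := mul_le_mul_of_nonneg_left h1 (by positivity : 0 ≤ 4 * β * lamMin)
      have e1 : 4 * β * lamMin * (1 / (β * lamMin) * L) = 4 * L := by field_simp
      have e2 : 4 * β * lamMin * ((1 / 2) * ((∑ ℓ, ((X i).1 ℓ - (X j).1 ℓ) ^ 2) / (2 * lamMin)))
        = β * ∑ ℓ, ((X i).1 ℓ - (X j).1 ℓ) ^ 2 := by field_simp; try ring
      rwa [e1, e2] at h3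
    refine h2.trans (mul_le_mul_of_nonneg_left ?_ hβpos.le)
    rw [norm_sub_rev, ← dBW_eq, dBW, Real.sq_sqrt (by positivity)]
    exact le_add_of_nonneg_right (Finset.sum_nonneg fun _ _ => sq_nonneg _)
  have hA4 : 4 * MW ^ 2 ≤ A := by
    rw [hA]; exact le_add_of_nonneg_right (by positivity)
  obtain ⟨y, ⟨hyr, hyf⟩, huniq⟩ := softT_unique hN β MW A hβpos (fun k => embG (X k)) i hM hA4 hP hD
    (lt_of_le_of_lt (le_max_left _ _) hNbig)
  have hinj : ∀ a b : GaussParam d, (∀ ℓ, 0 ≤ a.2 ℓ) → (∀ ℓ, 0 ≤ b.2 ℓ) → embG a = embG b → a = b := by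
    intro a b ha hb hab
    refine Prod.ext (funext fun ℓ => ?_) (funext fun ℓ => ?_)
    · rw [← embG_inl, ← embG_inl, hab]
    · have : Real.sqrt (a.2 ℓ) = Real.sqrt (b.2 ℓ) := by rw [← embG_inr, ← embG_inr, hab]
      exact (Real.sqrt_inj (ha ℓ) (hb ℓ)).1 this
  -- box property of Phi
  have hbox : ∀ ξ ℓ, (PhiOp β X ξ).2 ℓ ∈ Set.Icc lamMin lamMax := by
    intro ξ ℓ
    have hSpos : 0 < ∑ j, Real.exp (-β * (dBW (X j) ξ) ^ 2) :=
      Finset.sum_pos (fun j _ => Real.exp_pos _) ⟨i, Finset.mem_univ i⟩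
    have hw : ∀ k, 0 ≤ gibbsW β X ξ k := fun k => div_nonneg (Real.exp_pos _).le hSpos.le
    have hw1 : ∑ k, gibbsW β X ξ k = 1 := by
      simp only [gibbsW]; rw [← Finset.sum_div, div_self hSpos.ne']
    have lo : Real.sqrt lamMin ≤ ∑ k, gibbsW β X ξ k * Real.sqrt ((X k).2 ℓ) := by
      rw [← one_mul (Real.sqrt lamMin), ← hw1, Finset.sum_mul]
      exact Finset.sum_le_sum fun k _ =>
        mul_le_mul_of_nonneg_left (Real.sqrt_le_sqrt (hX k ℓ).1) (hw k)
    have hi : ∑ k, gibbsW β X ξ k * Real.sqrt ((X k).2 ℓ) ≤ Real.sqrt lamMax := by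
      rw [← one_mul (Real.sqrt lamMax), ← hw1, Finset.sum_mul]
      exact Finset.sum_le_sum fun k _ =>
        mul_le_mul_of_nonneg_left (Real.sqrt_le_sqrt (hX k ℓ).2) (hw k)
    have h0 := Real.sqrt_nonneg lamMin
    refine ⟨?_, ?_⟩
    · have := pow_le_pow_left₀ h0 lo 2
      rwa [Real.sq_sqrt hlam.le] at this
    · have := pow_le_pow_left₀ (h0.trans lo) hi 2
      rwa [Real.sq_sqrt hmaxpos.le] at this
  have hynn : ∀ ℓ, 0 ≤ y (Sum.inr ℓ) := by
    intro ℓ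
    rw [← hyf]
    simp only [softT, WithLp.ofLp_sum, WithLp.ofLp_smul, Finset.sum_apply, Pi.smul_apply, smul_eq_mul,
      embG_inr]
    exact Finset.sum_nonneg fun k _ => mul_nonneg (div_nonneg (Real.exp_pos _).le
      (Finset.sum_nonneg fun j _ => (Real.exp_pos _).le)) (Real.sqrt_nonneg _)
  set ξ : GaussParam d := (fun ℓ => y (Sum.inl ℓ), fun ℓ => y (Sum.inr ℓ) ^ 2) with hξ
  have hξy : embG ξ = y := by
    ext s
    rcases s with ℓ | ℓ
    · rfl
    · rw [embG_inr]; exact Real.sqrt_sq (hynn ℓ)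
  have hfix : PhiOp β X ξ = ξ := by
    refine hinj _ _ (fun ℓ => hlam.le.trans (hbox ξ ℓ).1) (fun ℓ => sq_nonneg _) ?_
    rw [embG_Phi, hξy, hyf]
  refine ⟨ξ, ⟨⟨?_, ?_⟩, hfix⟩, ?_⟩
  · rw [dBW_eq, hξy]; exact hyr
  · intro ℓ; rw [← hfix]; exact hbox ξ ℓ
  · rintro η ⟨⟨h1, h2⟩, h3⟩
    refine hinj _ _ (fun ℓ => hlam.le.trans (h2 ℓ).1) (fun ℓ => sq_nonneg _) ?_
    rw [hξy]
    refine huniq _ ⟨?_, ?_⟩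
    · rw [← dBW_eq]; exact h1
    · rw [← embG_Phi, h3]
end

section
/- Suppose the separation condition holds at index i, the beta constraint holds, and N > max{144 β M_W², 1/((4 M_W² + 2d(λ_max + λ_min)) β)}. Then for every query ξ ∈ B_i, the one-step retrieval error satisfies d_BW(Φ(ξ), X_i) ≤ 3/√(βN). -/
open Real Finset MeasureTheory

noncomputable def embBW {d : ℕ} (x : GaussParam d) : EuclideanSpace ℝ (Fin d ⊕ Fin d) :=
  WithLp.toLp 2 (Sum.elim x.1 (fun l => Real.sqrt (x.2 l)))

lemma dBW_eq_norm {d : ℕ} (x y : GaussParam d) : dBW x y = ‖embBW x - embBW y‖ := by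
  rw [EuclideanSpace.norm_eq, dBW, Fintype.sum_sum_type]
  simp [embBW]

lemma embBW_norm_sq {d : ℕ} (x : GaussParam d) (hx : ∀ l, 0 ≤ x.2 l) :
    ‖embBW x‖ ^ 2 = (∑ l, (x.1 l) ^ 2) + ∑ l, x.2 l := by
  rw [EuclideanSpace.norm_sq_eq, Fintype.sum_sum_type]
  simp [embBW, Real.sq_sqrt (hx _)]

lemma gibbsW_nonneg {d N : ℕ} (β : ℝ) (X : Fin N → GaussParam d) (ξ : GaussParam d)
    (k : Fin N) : 0 ≤ gibbsW β X ξ k := by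
  unfold gibbsW; positivity

lemma gibbsW_sum {d N : ℕ} (hN : 0 < N) (β : ℝ) (X : Fin N → GaussParam d)
    (ξ : GaussParam d) : ∑ k, gibbsW β X ξ k = 1 := by
  have : Nonempty (Fin N) := ⟨⟨0, hN⟩⟩
  unfold gibbsW
  rw [← Finset.sum_div]
  exact div_self (ne_of_gt (Finset.sum_pos (fun _ _ => Real.exp_pos _) Finset.univ_nonempty))

lemma embBW_Phi {d N : ℕ} (β : ℝ) (X : Fin N → GaussParam d) (ξ : GaussParam d) :
    embBW (PhiOp β X ξ) = ∑ k, gibbsW β X ξ k • embBW (X k) := by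
  ext l
  cases l with
  | inl l => simp [embBW, PhiOp]
  | inr l =>
    simp only [embBW, PhiOp, Sum.elim_inr, WithLp.ofLp_sum, WithLp.ofLp_smul, Finset.sum_apply,
      Pi.smul_apply, smul_eq_mul]
    exact Real.sqrt_sq (Finset.sum_nonneg fun k _ =>
      mul_nonneg (gibbsW_nonneg _ _ _ _) (Real.sqrt_nonneg _))

lemma gibbsW_le {d N : ℕ} (β : ℝ) (X : Fin N → GaussParam d) (ξ : GaussParam d)
    (i k : Fin N) :
    gibbsW β X ξ k ≤ Real.exp (-(β * ((dBW (X k) ξ) ^ 2 - (dBW (X i) ξ) ^ 2))) := by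
  unfold gibbsW
  have h : Real.exp (-β * (dBW (X i) ξ) ^ 2) ≤ ∑ j, Real.exp (-β * (dBW (X j) ξ) ^ 2) :=
    Finset.single_le_sum (f := fun j => Real.exp (-β * (dBW (X j) ξ) ^ 2))
      (fun _ _ => (Real.exp_pos _).le) (Finset.mem_univ i)
  calc _ ≤ Real.exp (-β * (dBW (X k) ξ) ^ 2) / Real.exp (-β * (dBW (X i) ξ) ^ 2) := by gcongr
    _ = _ := by rw [← Real.exp_sub]; congr 1; ring

lemma Ifun_le {d : ℕ} (a b : ℝ) (ha : 0 < a) (x y : GaussParam d)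
    (hx : ∀ l, x.2 l ∈ Set.Icc a b) (hy : ∀ l, y.2 l ∈ Set.Icc a b) :
    Ifun x y ≤ (d / 2 : ℝ) * Real.log (4 * Real.pi * b) + (dBW x y) ^ 2 / (4 * a) := by
  rcases Nat.eq_zero_or_pos d with rfl | hd
  · simp [Ifun, dBW]
  have hb : 0 < b := by
    have := hx ⟨0, hd⟩
    linarith [this.1, this.2]
  have h1 : ∑ l, Real.log (x.2 l + y.2 l) ≤ d * Real.log (2 * b) := by
    calc _ ≤ ∑ l : Fin d, Real.log (2 * b) := by
          apply Finset.sum_le_sum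
          intro l _
          exact Real.log_le_log (by linarith [(hx l).1, (hy l).1])
            (by linarith [(hx l).2, (hy l).2])
      _ = _ := by simp
  have h2 : ∑ l, (x.1 l - y.1 l) ^ 2 / (x.2 l + y.2 l) ≤ (dBW x y) ^ 2 / (2 * a) := by
    calc _ ≤ ∑ l : Fin d, (x.1 l - y.1 l) ^ 2 / (2 * a) := by
          apply Finset.sum_le_sum
          intro l _
          exact div_le_div_of_nonneg_left (sq_nonneg _) (by linarith)
            (by linarith [(hx l).1, (hy l).1])
      _ = (∑ l : Fin d, (x.1 l - y.1 l) ^ 2) / (2 * a) := by rw [Finset.sum_div]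
      _ ≤ _ := by
          rw [dBW, Real.sq_sqrt (by positivity)]
          gcongr
          have : 0 ≤ ∑ l, (Real.sqrt (x.2 l) - Real.sqrt (y.2 l)) ^ 2 := by positivity
          linarith
  have h3 : Real.log (4 * Real.pi * b) = Real.log (2 * Real.pi) + Real.log (2 * b) := by
    rw [← Real.log_mul (by positivity) (by positivity)]; congr 1; ring
  have h4 : (dBW x y) ^ 2 / (4 * a) = (1 / 2) * ((dBW x y) ^ 2 / (2 * a)) := by
    field_simp; ring
  rw [Ifun, h3, h4]
  linarith

/-- Under the separation condition, the beta constraint and the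
size condition on `N`, the one-step retrieval error satisfies
`d_BW(Φ(ξ), X_i) ≤ 3/√(βN)` for every query `ξ ∈ B_i`. -/
theorem phi_one_step_retrieval_error
    {d N : ℕ} (hN : 0 < N) (β lamMin lamMax MW : ℝ)
    (hβpos : 0 < β) (hlam : 0 < lamMin) (hlam' : lamMin ≤ lamMax)
    (X : Fin N → GaussParam d)
    (hX : ∀ i ℓ, (X i).2 ℓ ∈ Set.Icc lamMin lamMax)
    (hMW : MW = ⨆ k, Real.sqrt ((∑ ℓ, ((X k).1 ℓ) ^ 2) + ∑ ℓ, (X k).2 ℓ))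
    (i : Fin N)
    (hsep : ∀ j, j ≠ i → Ifun (X i) (X j) ≥
      (d / 2 : ℝ) * Real.log (4 * Real.pi * lamMax) +
        (1 / (β * lamMin)) *
          Real.log ((N : ℝ) ^ 3 * β * (4 * MW ^ 2 + 2 * d * (lamMax + lamMin))))
    (hβc : β > Real.exp 2 / ((4 * MW ^ 2 + 2 * d * (lamMax + lamMin)) * (N : ℝ) ^ 3))
    (hNbig : (N : ℝ) > max (144 * β * MW ^ 2)
      (1 / ((4 * MW ^ 2 + 2 * d * (lamMax + lamMin)) * β)))
    (ξ : GaussParam d)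
    (hξeig : ∀ ℓ, ξ.2 ℓ ∈ Set.Icc lamMin lamMax)
    (hξball : dBW (X i) ξ ≤ 1 / Real.sqrt (β * N)) :
    dBW (PhiOp β X ξ) (X i) ≤ 3 / Real.sqrt (β * N) := by
  rcases Nat.eq_zero_or_pos d with hd | hd
  · subst hd
    have : dBW (PhiOp β X ξ) (X i) = 0 := by simp [dBW]
    rw [this]; positivity
  have hNr : (0 : ℝ) < N := by exact_mod_cast hN
  have hdr : (0 : ℝ) < d := by exact_mod_cast hd
  set r := 1 / Real.sqrt (β * N) with hr
  have hrpos : 0 < r := by positivity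
  have hr2 : β * N * r ^ 2 = 1 := by
    rw [hr, div_pow, Real.sq_sqrt (by positivity)]; field_simp
  have h3r : 3 / Real.sqrt (β * N) = 3 * r := by rw [hr]; ring
  rw [h3r]
  set K := 4 * MW ^ 2 + 2 * d * (lamMax + lamMin) with hK
  have hKM : 4 * MW ^ 2 ≤ K := by
    have : 0 ≤ 2 * d * (lamMax + lamMin) := mul_nonneg (by positivity) (by linarith)
    linarith
  have hKpos : 0 < K := by
    have : 0 < 2 * d * (lamMax + lamMin) := mul_pos (by positivity) (by linarith)
    have := sq_nonneg MW
    linarith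
  set A := (N : ℝ) ^ 3 * β * K with hA
  have hApos : 0 < A := by positivity
  have hAe : Real.exp 2 < A := by
    rw [gt_iff_lt, div_lt_iff₀ (by positivity)] at hβc
    rw [hA]; linarith
  have hL : 2 < Real.log A := (Real.lt_log_iff_exp_lt hApos).2 hAe
  have hnorm : ∀ k, ‖embBW (X k)‖ ≤ MW := by
    intro k
    have hk := embBW_norm_sq (X k) (fun l => hlam.le.trans (hX k l).1)
    have : ‖embBW (X k)‖ = Real.sqrt ((∑ ℓ, ((X k).1 ℓ) ^ 2) + ∑ ℓ, (X k).2 ℓ) := by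
      rw [← hk, Real.sqrt_sq (norm_nonneg _)]
    rw [this, hMW]
    exact le_ciSup (f := fun k => Real.sqrt ((∑ ℓ, ((X k).1 ℓ) ^ 2) + ∑ ℓ, (X k).2 ℓ))
      (Set.finite_range _).bddAbove k
  have key : ∀ j, gibbsW β X ξ j * ‖embBW (X j) - embBW (X i)‖ ≤ r / N := by
    intro j
    by_cases hj : j = i
    · subst hj; simp; positivity
    have hN2 : (2 : ℝ) ≤ N := by
      have h1 := j.2
      have h2 := i.2
      have h3 : j.1 ≠ i.1 := fun h => hj (Fin.ext h)
      have : 2 ≤ N := by omega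
      exact_mod_cast this
    set D := ‖embBW (X j) - embBW (X i)‖ with hD
    have hD0 : 0 ≤ D := norm_nonneg _
    have hDd : dBW (X i) (X j) = D := by rw [dBW_eq_norm, norm_sub_rev]
    have hDM : D ≤ 2 * MW := by
      have := norm_sub_le (embBW (X j)) (embBW (X i))
      linarith [hnorm i, hnorm j]
    have hD2 : 4 * Real.log A ≤ β * D ^ 2 := by
      have h1 := hsep j hj
      have h2 := Ifun_le lamMin lamMax hlam (X i) (X j) (hX i) (hX j)
      rw [hDd] at h2
      have h3 : 1 / (β * lamMin) * Real.log A ≤ D ^ 2 / (4 * lamMin) := by linarith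
      rw [div_mul_eq_mul_div, one_mul, div_le_div_iff₀ (by positivity) (by positivity)] at h3
      have h4 : 4 * Real.log A * lamMin ≤ β * D ^ 2 * lamMin := by linarith
      exact le_of_mul_le_mul_right h4 hlam
    have hD4 : 4 * r ≤ D := by
      refine (sq_le_sq₀ (by positivity) hD0).1 ?_
      have h1 : β * (2 * r ^ 2) ≤ β * N * r ^ 2 := by
        have : 0 ≤ β * r ^ 2 := by positivity
        nlinarith
      have h2 : β * (4 * r) ^ 2 ≤ β * D ^ 2 := by linarith
      exact le_of_mul_le_mul_left h2 hβpos
    have hw : gibbsW β X ξ j ≤ 1 / A := by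
      refine (gibbsW_le β X ξ i j).trans ?_
      have hone : 1 / A = Real.exp (-Real.log A) := by
        rw [Real.exp_neg, Real.exp_log hApos, one_div]
      rw [hone, Real.exp_le_exp, neg_le_neg_iff]
      have htri : D ≤ dBW (X j) ξ + dBW (X i) ξ := by
        rw [dBW_eq_norm, dBW_eq_norm, norm_sub_rev (embBW (X i))]
        exact norm_sub_le_norm_sub_add_norm_sub _ _ _
      have hb0 : 0 ≤ dBW (X i) ξ := Real.sqrt_nonneg _
      set a := dBW (X j) ξ
      set b := dBW (X i) ξ
      have h1 : D ^ 2 / 2 ≤ a ^ 2 - b ^ 2 := by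
        have h2 : (D - b) ^ 2 ≤ a ^ 2 := by
          apply pow_le_pow_left₀ <;> linarith
        have h3 : 0 ≤ D * (D - 4 * b) := mul_nonneg hD0 (by linarith)
        linarith
      have h5 : β * (D ^ 2 / 2) ≤ β * (a ^ 2 - b ^ 2) := by gcongr
      linarith
    calc gibbsW β X ξ j * D ≤ 1 / A * D := by gcongr
      _ ≤ r / N := by
        rw [div_mul_eq_mul_div, one_mul, div_le_div_iff₀ hApos hNr]
        have h1 : D ^ 2 ≤ K := by
          have h9 : D ^ 2 ≤ (2 * MW) ^ 2 := pow_le_pow_left₀ hD0 hDM 2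
          linarith
        have h2 : (N : ℝ) ^ 3 * β * (4 * r * D) ≤ A := by
          have h8 : 4 * r * D ≤ D * D := mul_le_mul_of_nonneg_right hD4 hD0
          have h7 : 4 * r * D ≤ K := by linarith
          exact mul_le_mul_of_nonneg_left h7 (by positivity)
        calc D * N ≤ D * (4 * N ^ 2) := by gcongr; nlinarith
          _ = r * ((N : ℝ) ^ 3 * β * (4 * r * D)) := by
            linear_combination (-(4 * D * N ^ 2)) * hr2
          _ ≤ r * A := by gcongr
  have hsum : embBW (PhiOp β X ξ) - embBW (X i)
      = ∑ k, gibbsW β X ξ k • (embBW (X k) - embBW (X i)) := by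
    simp_rw [smul_sub]
    rw [Finset.sum_sub_distrib, ← Finset.sum_smul, gibbsW_sum hN, one_smul, embBW_Phi]
  rw [dBW_eq_norm, hsum]
  calc _ ≤ ∑ k, ‖gibbsW β X ξ k • (embBW (X k) - embBW (X i))‖ := norm_sum_le _ _
    _ ≤ ∑ k : Fin N, r / N := by
      apply Finset.sum_le_sum
      intro k _
      rw [norm_smul, Real.norm_of_nonneg (gibbsW_nonneg _ _ _ _)]
      exact key k
    _ = r := by simp; field_simp
    _ ≤ 3 * r := by linarith
end
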